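/- arXiv:0902.2277 — 3 statements merged into one kernel-verified Lean document; each statement's English description precedes it below -/
import Mathlib

section
/- Let f = Y²Z − X³ − X²Z in ℂ[X,Y,Z] and define φ : ℂ² → ℂ³ by φ(s,t) = (s(t²−s²), t(t²−s²), s³). Then (i) for all s, t ∈ ℂ one has f(φ(s,t)) = 0, and (ii) for every (x,y,z) ∈ ℂ³ \ {0} with f(x,y,z) = 0 there exist (s,t) ∈ ℂ² \ {(0,0)} and λ ∈ ℂ \ {0} such that (x,y,z) = λ·φ(s,t). In other words, φ is a homogeneous rational parametrization of the projective cubic D = {f = 0} ⊂ ℙ²(ℂ), so D is a rational curve. -/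
open MvPolynomial

/-- The homogeneous cubic `f = Y²Z − X³ − X²Z` in `ℂ[X,Y,Z]`. -/
noncomputable def f : MvPolynomial (Fin 3) ℂ :=
  (X 1) ^ 2 * X 2 - (X 0) ^ 3 - (X 0) ^ 2 * X 2

/-- The homogeneous parametrization `φ(s,t) = (s(t²−s²), t(t²−s²), s³)`. -/
noncomputable def φ (s t : ℂ) : Fin 3 → ℂ :=
  ![s * (t ^ 2 - s ^ 2), t * (t ^ 2 - s ^ 2), s ^ 3]

theorem stmt0 :
    (∀ s t : ℂ, eval (φ s t) f = 0) ∧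
    (∀ x y z : ℂ, (x, y, z) ≠ (0, 0, 0) → eval ![x, y, z] f = 0 →
      ∃ s t lam : ℂ, (s, t) ≠ (0, 0) ∧ lam ≠ 0 ∧
        x = lam * (s * (t ^ 2 - s ^ 2)) ∧
        y = lam * (t * (t ^ 2 - s ^ 2)) ∧
        z = lam * s ^ 3) := by
  refine ⟨fun s t => ?_, fun x y z hne h => ?_⟩
  · simp [f, φ]
    ring
  · have hf : y ^ 2 * z - x ^ 3 - x ^ 2 * z = 0 := by simpa [f] using h
    by_cases hx : x = 0
    · subst hx
      by_cases hy : y = 0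
      · subst hy
        have hz : z ≠ 0 := by
          rintro rfl
          exact hne rfl
        exact ⟨1, 1, z, by simp, hz, by simp, by simp, by simp⟩
      · have hz : z = 0 := by simpa [hy] using hf
        exact ⟨0, 1, y, by simp, hy, by simp, by simp, by simpa using hz⟩
    · have hxyz : z * (y ^ 2 - x ^ 2) = x ^ 3 := by linear_combination hf
      have hw : y ^ 2 - x ^ 2 ≠ 0 := right_ne_zero_of_mul (hxyz ▸ pow_ne_zero 3 hx)
      refine ⟨x, y, (y ^ 2 - x ^ 2)⁻¹, by simp [hx], inv_ne_zero hw, ?_, ?_, ?_⟩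
      · field_simp
      · field_simp
      · rw [← hxyz]
        field_simp
end

section
/- Let f₁ = Y²Z + (1/2)XYZ + YZ² − (9/8)X³ − 2X²Z − XZ² in ℂ[X,Y,Z]. The set of points (x,y,z) ∈ ℂ³ \ {0} at which all three partial derivatives ∂f₁/∂X, ∂f₁/∂Y, ∂f₁/∂Z simultaneously vanish is exactly {λ·(−2,−1,3) : λ ∈ ℂ, λ ≠ 0}. Consequently [−2/3 : −1/3 : 1] is the unique singular point of the projective cubic D₁ = {f₁ = 0} ⊂ ℙ²(ℂ). -/
open MvPolynomial

/-- The homogeneous cubic `f₁ = Y²Z + (1/2)XYZ + YZ² − (9/8)X³ − 2X²Z − XZ²` in `ℂ[X,Y,Z]`. -/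
noncomputable def f₁ : MvPolynomial (Fin 3) ℂ :=
  (X 1) ^ 2 * X 2 + C (1 / 2) * X 0 * X 1 * X 2 + X 1 * (X 2) ^ 2
    - C (9 / 8) * (X 0) ^ 3 - 2 * (X 0) ^ 2 * X 2 - X 0 * (X 2) ^ 2

/-- The three partial derivatives of `f₁` vanish at `(x, y, z)` iff the explicit quadrics do. -/
theorem forall_eval_pderiv_f₁_eq_zero_iff (x y z : ℂ) :
    (∀ i : Fin 3, eval ![x, y, z] (pderiv i f₁) = 0) ↔
      1 / 2 * y * z - 27 / 8 * x ^ 2 - 4 * x * z - z ^ 2 = 0 ∧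
      2 * y * z + 1 / 2 * x * z + z ^ 2 = 0 ∧
      y ^ 2 + 1 / 2 * x * y + 2 * y * z - 2 * x ^ 2 - 2 * x * z = 0 := by
  have two_eq : (2 : MvPolynomial (Fin 3) ℂ) = C 2 := (map_ofNat C 2).symm
  have h0 : eval ![x, y, z] (pderiv 0 f₁) =
      1 / 2 * y * z - 27 / 8 * x ^ 2 - 4 * x * z - z ^ 2 := by
    simp [f₁, two_eq, pderiv_X]
    ring
  have h1 : eval ![x, y, z] (pderiv 1 f₁) = 2 * y * z + 1 / 2 * x * z + z ^ 2 := by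
    simp [f₁, two_eq, pderiv_X]
    ring
  have h2 : eval ![x, y, z] (pderiv 2 f₁) =
      y ^ 2 + 1 / 2 * x * y + 2 * y * z - 2 * x ^ 2 - 2 * x * z := by
    simp [f₁, two_eq, pderiv_X]
    ring
  rw [Fin.forall_fin_succ, Fin.forall_fin_two]
  change eval _ (pderiv 0 f₁) = 0 ∧ eval _ (pderiv 1 f₁) = 0 ∧ eval _ (pderiv 2 f₁) = 0 ↔ _
  rw [h0, h1, h2]

theorem stmt3 :
    {p : ℂ × ℂ × ℂ | p ≠ (0, 0, 0) ∧
        ∀ i : Fin 3, eval ![p.1, p.2.1, p.2.2] (pderiv i f₁) = 0}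
      = {p : ℂ × ℂ × ℂ | ∃ lam : ℂ, lam ≠ 0 ∧ p = (lam * (-2), lam * (-1), lam * 3)} := by
  ext ⟨x, y, z⟩
  simp only [Set.mem_ofPred_eq, forall_eval_pderiv_f₁_eq_zero_iff, Prod.mk.injEq, ne_eq]
  constructor
  · rintro ⟨hne, hX, hY, hZ⟩
    have hz : z ≠ 0 := by
      rintro rfl
      have hx : x = 0 := by simpa using hX
      subst hx
      have hy : y = 0 := by simpa using hZ
      exact hne ⟨rfl, hy, rfl⟩
    have hy : y = -(x + 2 * z) / 4 := by
      apply mul_left_cancel₀ hz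
      linear_combination 1 / 2 * hY
    subst hy
    have hx : 3 * x + 2 * z = 0 := by
      by_contra h
      have h₁ : 9 * x + 5 * z = 0 := by
        apply mul_left_cancel₀ h
        linear_combination -8 * hX
      have h₂ : 11 * x + 6 * z = 0 := by
        apply mul_left_cancel₀ h
        linear_combination -16 * hZ
      exact hz (by linear_combination 11 * h₁ - 9 * h₂)
    refine ⟨z / 3, div_ne_zero hz three_ne_zero, ?_, ?_, ?_⟩
    · linear_combination 1 / 3 * hx
    · linear_combination -1 / 12 * hx
    · ring
  · rintro ⟨lam, hlam, rfl, rfl, rfl⟩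
    refine ⟨by simp [hlam], ?_, ?_, ?_⟩ <;> ring
end

section
/- Let f₂ = Y²Z + 2XYZ + 2YZ² − 2X³ − 4X²Z − 2XZ² in ℂ[X,Y,Z]. The set of points (x,y,z) ∈ ℂ³ \ {0} at which all three partial derivatives ∂f₂/∂X, ∂f₂/∂Y, ∂f₂/∂Z simultaneously vanish is exactly {λ·(−1,0,1) : λ ∈ ℂ, λ ≠ 0}. Consequently [−1:0:1] is the unique singular point of the projective cubic D₂ = {f₂ = 0} ⊂ ℙ²(ℂ). -/
open MvPolynomial

/-- The homogeneous cubic `f₂ = Y²Z + 2XYZ + 2YZ² − 2X³ − 4X²Z − 2XZ²` in `ℂ[X,Y,Z]`. -/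
noncomputable def f₂ : MvPolynomial (Fin 3) ℂ :=
  (X 1) ^ 2 * X 2 + 2 * X 0 * X 1 * X 2 + 2 * X 1 * (X 2) ^ 2
    - 2 * (X 0) ^ 3 - 4 * (X 0) ^ 2 * X 2 - 2 * X 0 * (X 2) ^ 2

theorem pderiv_ofNat {R σ : Type*} [CommSemiring R] (i : σ) (n : ℕ) [n.AtLeastTwo] :
    pderiv i (ofNat(n) : MvPolynomial σ R) = 0 :=
  (pderiv i).map_natCast n

theorem eval_pderiv_zero_f₂ (x y z : ℂ) :
    eval ![x, y, z] (pderiv 0 f₂) = 2 * y * z - 6 * x ^ 2 - 8 * x * z - 2 * z ^ 2 := by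
  simp [f₂, pderiv_X, pderiv_ofNat]
  ring

theorem eval_pderiv_one_f₂ (x y z : ℂ) :
    eval ![x, y, z] (pderiv 1 f₂) = 2 * y * z + 2 * x * z + 2 * z ^ 2 := by
  simp [f₂, pderiv_X, pderiv_ofNat]
  ring

theorem eval_pderiv_two_f₂ (x y z : ℂ) :
    eval ![x, y, z] (pderiv 2 f₂)
      = y ^ 2 + 2 * x * y + 4 * y * z - 4 * x ^ 2 - 4 * x * z := by
  simp [f₂, pderiv_X, pderiv_ofNat]
  ring

theorem stmt4 :
    {p : ℂ × ℂ × ℂ | p ≠ (0, 0, 0) ∧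
        ∀ i : Fin 3, eval ![p.1, p.2.1, p.2.2] (pderiv i f₂) = 0}
      = {p : ℂ × ℂ × ℂ | ∃ lam : ℂ, lam ≠ 0 ∧ p = (lam * (-1), 0, lam * 1)} := by
  ext ⟨x, y, z⟩
  simp only [Set.mem_ofPred_eq, Fin.forall_fin_succ, Fin.succ_zero_eq_one,
    Fin.succ_one_eq_two, IsEmpty.forall_iff, and_true, eval_pderiv_zero_f₂, eval_pderiv_one_f₂,
    eval_pderiv_two_f₂]
  constructor
  · rintro ⟨hne, hX, hY, hZ⟩
    have hz : z ≠ 0 := by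
      rintro rfl
      have hx : x = 0 := by simpa using hX
      subst hx
      have hy : y = 0 := by simpa using hZ
      exact hne (by rw [hy])
    have hy : y = -(x + z) := by
      have h : (2 * z) * (x + y + z) = 0 := by linear_combination hY
      have h' := (mul_eq_zero.mp h).resolve_left (mul_ne_zero two_ne_zero hz)
      linear_combination h'
    subst hy
    have hxz : x + z = 0 := by
      have h : z * (x + z) = 0 := by linear_combination (-5 / 2) * hX + 3 * hZ
      exact (mul_eq_zero.mp h).resolve_left hz
    refine ⟨z, hz, ?_⟩
    rw [eq_neg_of_add_eq_zero_left hxz]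
    simp
  · rintro ⟨lam, hlam, h⟩
    obtain ⟨rfl, rfl, rfl⟩ : x = lam * (-1) ∧ y = 0 ∧ z = lam * 1 := by simpa using h
    refine ⟨by simpa using hlam, ?_, ?_, ?_⟩ <;> ring
end
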